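/- Let Λ ⊂ ℝ^m be a full-rank lattice with covolume det(Λ), and let 𝒞 ⊂ ℝ^m be a bounded convex set containing the origin. If Λ ∩ 𝒞 contains m linearly independent vectors, then the number of lattice points satisfies |Λ ∩ 𝒞| ≤ m! · vol(𝒞)/det(Λ) + m ≤ (m+1)! · vol(𝒞)/det(Λ). -/

import Mathlib

open MeasureTheory

noncomputable section


lemma simplex_vol (m : ℕ) :
    ENNReal.ofReal (1 / (m.factorial : ℝ)) ≤
      volume {x : Fin m → ℝ | (∀ i, 0 ≤ x i) ∧ ∑ i, x i ≤ 1} := by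
  classical
  set D : Set (Fin m → ℝ) := {x : Fin m → ℝ | (∀ i, 0 ≤ x i) ∧ ∑ i, x i ≤ 1} with hD
  have hDm : MeasurableSet D := by
    apply IsClosed.measurableSet
    apply IsClosed.inter (s₁ := {x : Fin m → ℝ | ∀ i, 0 ≤ x i})
      (s₂ := {x : Fin m → ℝ | ∑ i, x i ≤ 1})
    · rw [Set.ofPred_forall]
      exact isClosed_iInter fun i => isClosed_le (by fun_prop) (by fun_prop)
    · exact isClosed_le (by fun_prop) (by fun_prop)
  let g : (Fin m → Bool) → (Fin m → ℝ) → (Fin m → ℝ) :=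
    fun ε x i => (if ε i then (fun y : ℝ => y) else (fun y : ℝ => -y)) (x i)
  have hg : ∀ ε, MeasurePreserving (g ε) volume volume := by
    intro ε
    apply volume_preserving_pi (f := fun i => (if ε i then (fun y : ℝ => y) else (fun y : ℝ => -y)))
    intro i
    split_ifs
    · exact MeasurePreserving.id _
    · exact Measure.measurePreserving_neg _
  have hsub : {x : Fin m → ℝ | ∑ i, |x i| ^ (1:ℝ) < 1} ⊆ ⋃ ε ∈ (Finset.univ : Finset (Fin m → Bool)), g ε ⁻¹' D := by
    intro x hx
    simp only [Real.rpow_one, Set.mem_ofPred_eq] at hx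
    simp only [Set.mem_iUnion]
    have key : ∀ i, g (fun i => decide (0 ≤ x i)) x i = |x i| := by
      intro i
      by_cases h : 0 ≤ x i
      · simp [g, h, abs_of_nonneg]
      · simp [g, h, abs_of_neg (not_le.mp h)]
    refine ⟨fun i => decide (0 ≤ x i), Finset.mem_univ _, ?_, ?_⟩
    · intro i; rw [key]; exact abs_nonneg _
    · simp only [key]; exact hx.le
  have h1 := (measure_mono (μ := volume) hsub).trans (measure_biUnion_finset_le _ _)
  simp only [(hg _).measure_preimage hDm.nullMeasurableSet] at h1
  rw [volume_sum_rpow_lt_one (Fin m) le_rfl] at h1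
  simp only [Finset.sum_const, Finset.card_univ, Fintype.card_fun, Fintype.card_bool, Fintype.card_fin,
    nsmul_eq_mul, div_one, Real.Gamma_nat_eq_factorial] at h1
  norm_num [Real.Gamma_two] at h1
  rw [div_eq_mul_inv, ENNReal.ofReal_mul (by positivity), ENNReal.ofReal_pow (by norm_num)] at h1
  simp only [ENNReal.ofReal_ofNat] at h1
  rw [one_div]
  exact (ENNReal.mul_le_mul_iff_right (by simp) (by simp)).1 h1

lemma tight_functional {E : Type*} [NormedAddCommGroup E] [NormedSpace ℝ E] (T : Finset E)
    (h0 : (0:E) ∉ convexHull ℝ (T : Set E)) (hs : Submodule.span ℝ (T : Set E) = ⊤) :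
    ∃ f : E →ₗ[ℝ] ℝ, (∀ t ∈ T, 1 ≤ f t) ∧
      Submodule.span ℝ {t : E | t ∈ T ∧ f t = 1} = ⊤ := by
  classical
  let A : Finset (Finset E) := T.powerset.filter fun P =>
    ∃ f : E →ₗ[ℝ] ℝ, (∀ t ∈ T, 1 ≤ f t) ∧ P = T.filter fun t => f t = 1
  have hA : A.Nonempty := by
    have hcl : IsClosed (convexHull ℝ (T : Set E)) :=
      T.finite_toSet.isClosed_convexHull ℝ
    obtain ⟨f, u, hu, hf⟩ := geometric_hahn_banach_point_closed (convex_convexHull ℝ _) hcl h0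
    simp only [map_zero] at hu
    refine ⟨T.filter fun t => (u⁻¹ • (f : E →ₗ[ℝ] ℝ)) t = 1, ?_⟩
    simp only [A, Finset.mem_filter, Finset.mem_powerset]
    refine ⟨Finset.filter_subset _ _, _, ?_, rfl⟩
    intro t ht
    have := hf t (subset_convexHull ℝ _ ht)
    simp only [LinearMap.smul_apply, smul_eq_mul]
    rw [← div_eq_inv_mul, le_div_iff₀ hu]
    simpa using this.le
  obtain ⟨P, hP, hmax⟩ := A.exists_max_image Finset.card hA
  simp only [A, Finset.mem_filter, Finset.mem_powerset] at hP
  obtain ⟨-, f, hf, rfl⟩ := hP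
  refine ⟨f, hf, ?_⟩
  by_contra hne
  obtain ⟨g, hg0, hgk⟩ := Submodule.exists_le_ker_of_lt_top _ (lt_top_iff_ne_top.2 hne)
  have hgP : ∀ t ∈ T, f t = 1 → g t = 0 := fun t ht h1 =>
    hgk (Submodule.subset_span ⟨ht, h1⟩)
  have hex : ∃ g : E →ₗ[ℝ] ℝ, (∀ t ∈ T, f t = 1 → g t = 0) ∧ ∃ t ∈ T, g t < 0 := by
    have : ∃ t ∈ T, g t ≠ 0 := by
      by_contra hcon
      push Not at hcon
      apply hg0
      apply LinearMap.ext_on hs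
      intro t ht
      simpa using hcon t ht
    obtain ⟨t, ht, hgt⟩ := this
    rcases lt_or_gt_of_ne hgt with h | h
    · exact ⟨g, hgP, t, ht, h⟩
    · exact ⟨-g, fun t ht h1 => by simp [hgP t ht h1], t, ht, by simpa using h⟩
  obtain ⟨g, hgP, t0, ht0, hgt0⟩ := hex
  obtain ⟨s, hsm, hsmin⟩ := (T.filter fun t => g t < 0).exists_min_image
    (fun t => (f t - 1) / (- g t)) ⟨t0, by simp [ht0, hgt0]⟩
  simp only [Finset.mem_filter] at hsm hsmin
  set c := (f s - 1) / (- g s) with hc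
  have hc0 : 0 ≤ c := div_nonneg (by linarith [hf s hsm.1]) (by linarith [hsm.2])
  have hs1 : (f + c • g) s = 1 := by
    have : g s ≠ 0 := hsm.2.ne
    simp only [LinearMap.add_apply, LinearMap.smul_apply, smul_eq_mul, hc]
    field_simp
    ring
  have hf' : ∀ t ∈ T, 1 ≤ (f + c • g) t := by
    intro t ht
    simp only [LinearMap.add_apply, LinearMap.smul_apply, smul_eq_mul]
    by_cases h : g t < 0
    · have := hsmin t ⟨ht, h⟩
      rw [le_div_iff₀ (by linarith)] at this
      linarith
    · have := mul_nonneg hc0 (not_lt.1 h)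
      linarith [hf t ht]
  have := hmax (T.filter fun t => (f + c • g) t = 1) (by
    simp only [A, Finset.mem_filter, Finset.mem_powerset]
    exact ⟨Finset.filter_subset _ _, _, hf', rfl⟩)
  refine absurd this (not_le.2 (Finset.card_lt_card ?_))
  rw [Finset.ssubset_iff_of_subset]
  · refine ⟨s, by simp only [Finset.mem_filter]; exact ⟨hsm.1, hs1⟩, ?_⟩
    intro h
    simp only [Finset.mem_filter] at h
    exact hsm.2.ne (hgP s h.1 h.2)
  · intro t ht
    simp only [Finset.mem_filter] at ht ⊢
    refine ⟨ht.1, ?_⟩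
    simp [hgP t ht.1 ht.2, ht.2]

lemma exists_removable {E : Type*} [NormedAddCommGroup E] [NormedSpace ℝ E]
    [FiniteDimensional ℝ E] [DecidableEq E] (S : Finset E)
    (hs : affineSpan ℝ (S : Set E) = ⊤) (hcard : Module.finrank ℝ E + 1 < S.card) :
    ∃ x ∈ S, x ∉ convexHull ℝ ((S.erase x : Finset E) : Set E) ∧
      affineSpan ℝ ((S.erase x : Finset E) : Set E) = ⊤ := by
  classical
  let R := S.filter fun x => x ∈ affineSpan ℝ ((S.erase x : Finset E) : Set E)
  have hspan : ∀ x ∈ R, affineSpan ℝ ((S.erase x : Finset E) : Set E) = ⊤ := by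
    intro x hx
    simp only [R, Finset.mem_filter] at hx
    rw [eq_top_iff, ← hs]
    apply affineSpan_le.2
    intro y hy
    by_cases h : y = x
    · subst h; exact hx.2
    · exact subset_affineSpan ℝ _ (by simp [h]; simpa using hy)
  have hR : R.Nonempty := by
    obtain ⟨t, htS, hts, hti⟩ := exists_affineIndependent ℝ E (S : Set E)
    have htf : t.Finite := S.finite_toSet.subset htS
    have : Fintype t := htf.fintype
    have h1 : Fintype.card t ≤ Module.finrank ℝ E + 1 :=
      hti.card_le_finrank_succ.trans (Nat.add_le_add_right (Submodule.finrank_le _) 1)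
    have h3 : ∃ x ∈ S, x ∉ t := by
      by_contra hcon
      push Not at hcon
      have : (S : Set E) = t := Set.Subset.antisymm hcon htS
      have h4 : S.card = Fintype.card t := by
        rw [← Set.ncard_coe_finset, this, ← Nat.card_coe_set_eq, Nat.card_eq_fintype_card]
      omega
    obtain ⟨x, hxS, hxt⟩ := h3
    refine ⟨x, ?_⟩
    simp only [R, Finset.mem_filter]
    refine ⟨hxS, ?_⟩
    have : x ∈ affineSpan ℝ t := by rw [hts, hs]; trivial
    refine affineSpan_mono ℝ ?_ this
    intro y hy
    have : y ≠ x := fun h => hxt (h ▸ hy)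
    simp only [Finset.mem_coe, Finset.mem_erase]
    exact ⟨this, htS hy⟩
  have hcomp : IsCompact (convexHull ℝ (R : Set E)) := R.finite_toSet.isCompact_convexHull ℝ
  obtain ⟨x, hx⟩ := hcomp.extremePoints_nonempty (by simpa using hR)
  have hxR : x ∈ R := by simpa using extremePoints_convexHull_subset hx
  have hxn : x ∉ convexHull ℝ ((R.erase x : Finset E) : Set E) := by
    rw [(convex_convexHull ℝ _).mem_extremePoints_iff_convex_sdiff] at hx
    intro hmem
    have : convexHull ℝ ((R.erase x : Finset E) : Set E) ⊆ convexHull ℝ (R : Set E) \ {x} := by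
      apply convexHull_min _ hx.2
      intro y hy
      simp at hy
      exact ⟨subset_convexHull ℝ _ hy.1, hy.2⟩
    exact (this hmem).2 rfl
  have hxS : x ∈ S := (Finset.mem_filter.1 hxR).1
  refine ⟨x, hxS, ?_, hspan x hxR⟩
  intro hmem
  apply hxn
  rw [Finset.mem_convexHull'] at hmem
  obtain ⟨w, hw0, hw1, hwx⟩ := hmem
  have hzero : ∀ k ∈ S.erase x, k ∉ R → w k = 0 := by
    intro k hk hkR
    by_contra hne
    apply hkR
    simp only [R, Finset.mem_filter]
    have hk' := Finset.mem_erase.1 hk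
    refine ⟨hk'.2, ?_⟩
    have hxk : x ≠ k := fun h => hk'.1 h.symm
    let w' : E → ℝ := fun j => if j = x then 1 / w k else - (w j / w k)
    have hins : S.erase k = insert x ((S.erase x).erase k) := by
      ext y
      simp only [Finset.mem_erase, Finset.mem_insert]
      by_cases hy : y = x
      · subst hy; simp [hxk, hxS]
      · simp [hy]
    have hnot : x ∉ (S.erase x).erase k := by simp
    have hw'e : ∀ j ∈ (S.erase x).erase k, w' j = - (w j / w k) := by
      intro j hj
      have : j ≠ x := (Finset.mem_erase.1 (Finset.mem_erase.1 hj).2).1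
      simp [w', this]
    have hw'x : w' x = 1 / w k := by simp [w']
    have hsum : ∑ j ∈ S.erase k, w' j = 1 := by
      rw [hins, Finset.sum_insert hnot, Finset.sum_congr rfl hw'e, hw'x,
        Finset.sum_neg_distrib, ← Finset.sum_div]
      have h3 := Finset.sum_erase_add _ w hk
      rw [hw1] at h3
      field_simp
      linarith
    have hcomb : ∑ j ∈ S.erase k, w' j • j = k := by
      have h4 : ∀ j ∈ (S.erase x).erase k, w' j • j = - ((w k)⁻¹ • (w j • j)) := by
        intro j hj
        rw [hw'e j hj, smul_smul, neg_smul, div_eq_inv_mul]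
      rw [hins, Finset.sum_insert hnot, Finset.sum_congr rfl h4, hw'x,
        Finset.sum_neg_distrib, ← Finset.smul_sum]
      have h3 := Finset.sum_erase_add _ (fun j => w j • j) hk
      simp only [hwx] at h3
      rw [← eq_sub_iff_add_eq] at h3
      rw [h3, smul_sub, smul_smul, inv_mul_cancel₀ hne, one_div, one_smul]
      abel
    have hsum' : ∑ j : (S.erase k), w' j = 1 := by
      rw [← hsum]; exact Finset.sum_coe_sort (S.erase k) w'
    have := affineCombination_mem_affineSpan (k := ℝ) (s := (Finset.univ : Finset (S.erase k)))
      (w := fun j => w' j) hsum' (fun j => (j : E))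
    rw [Finset.affineCombination_eq_linear_combination _ _ _
      hsum'] at this
    rw [Finset.sum_coe_sort (S.erase k) (fun j => w' j • j), hcomb] at this
    refine affineSpan_mono ℝ ?_ this
    rintro _ ⟨j, rfl⟩
    exact j.2
  rw [Finset.mem_convexHull']
  have hsubRS : R.erase x ⊆ S.erase x := Finset.erase_subset_erase _ (Finset.filter_subset _ _)
  refine ⟨w, fun y hy => hw0 y (hsubRS hy), ?_, ?_⟩
  · rw [← hw1]
    apply Finset.sum_subset hsubRS
    intro k hk hkn
    exact hzero k hk fun h => hkn (Finset.mem_erase.2 ⟨(Finset.mem_erase.1 hk).1, h⟩)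
  · refine Eq.trans ?_ hwx
    apply Finset.sum_subset hsubRS
    intro k hk hkn
    rw [hzero k hk fun h => hkn (Finset.mem_erase.2 ⟨(Finset.mem_erase.1 hk).1, h⟩), zero_smul]

lemma simplex_lattice {m : ℕ} (Λ : Submodule ℤ (EuclideanSpace ℝ (Fin m)))
    [DiscreteTopology Λ] [IsZLattice ℝ Λ]
    (b : Module.Basis (Fin m) ℝ (EuclideanSpace ℝ (Fin m))) (hb : ∀ i, b i ∈ Λ) :
    ZLattice.covolume Λ volume / m.factorial ≤
      volume.real (convexHull ℝ (insert 0 (Set.range b))) := by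
  set s := convexHull ℝ (insert 0 (Set.range b)) with hs
  have hfin : (insert 0 (Set.range b)).Finite := (Set.finite_range b).insert 0
  have hcomp : IsCompact s := hfin.isCompact_convexHull ℝ
  let L := Submodule.span ℤ (Set.range b)
  have hL : L ≤ Λ := Submodule.span_le.2 (by rintro _ ⟨i, rfl⟩; exact hb i)
  let bb : Module.Basis (Fin m) ℤ L := b.restrictScalars ℤ
  have hbb : ∀ i, bb.ofZLatticeBasis ℝ L i = b i := by
    intro i
    rw [Module.Basis.ofZLatticeBasis_apply]
    exact Module.Basis.restrictScalars_apply ℤ b i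
  have hvol := ZLattice.volume_image_eq_volume_div_covolume' L bb
    hcomp.measurableSet.nullMeasurableSet
  have hsub : {x : Fin m → ℝ | (∀ i, 0 ≤ x i) ∧ ∑ i, x i ≤ 1} ⊆
      (bb.ofZLatticeBasis ℝ L).equivFun '' s := by
    rintro x ⟨hx0, hx1⟩
    refine ⟨(bb.ofZLatticeBasis ℝ L).equivFun.symm x, ?_, LinearEquiv.apply_symm_apply _ _⟩
    rw [Module.Basis.equivFun_symm_apply]
    simp only [hbb]
    have hconv : Convex ℝ s := convex_convexHull ℝ _
    have h0 : (0 : EuclideanSpace ℝ (Fin m)) ∈ s := subset_convexHull ℝ _ (by simp)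
    have := hconv.sum_mem (t := (Finset.univ : Finset (Option (Fin m))))
      (w := fun o => o.elim (1 - ∑ i, x i) x) (z := fun o => o.elim 0 b) (by
        rintro (_ | i) _
        · simpa using hx1
        · exact hx0 i) (by simp [Fintype.sum_option]) (by
        rintro (_ | i) _
        · exact h0
        · exact subset_convexHull ℝ _ (by simp))
    simpa [Fintype.sum_option] using this
  have h1 := (simplex_vol m).trans (measure_mono (μ := volume) hsub)
  rw [hvol] at h1
  have hLpos : 0 < ZLattice.covolume L volume := ZLattice.covolume_pos L volume
  have hΛpos : 0 < ZLattice.covolume Λ volume := ZLattice.covolume_pos Λ volume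
  have hle : ZLattice.covolume Λ volume ≤ ZLattice.covolume L volume := by
    have h2 := ZLattice.covolume_div_covolume_eq_relIndex' L Λ hL
    have h3 : 0 < ZLattice.covolume L volume / ZLattice.covolume Λ volume := div_pos hLpos hΛpos
    rw [h2] at h3
    have h4 : (1 : ℝ) ≤ (L.toAddSubgroup.relIndex Λ.toAddSubgroup : ℝ) := by
      exact_mod_cast h3
    rw [← h2, le_div_iff₀ hΛpos, one_mul] at h4
    exact h4
  have hfinite : volume s ≠ ⊤ := hcomp.measure_lt_top.ne
  have h5 := ENNReal.toReal_mono (ENNReal.div_lt_top hfinite (by simpa using hLpos)).ne h1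
  rw [ENNReal.toReal_ofReal (by positivity), ENNReal.toReal_div,
    ENNReal.toReal_ofReal hLpos.le, le_div_iff₀ hLpos] at h5
  rw [Measure.real]
  refine le_trans ?_ h5
  rw [div_eq_mul_inv, mul_comm, one_div]
  gcongr

lemma increment_zero {m : ℕ} (Λ : Submodule ℤ (EuclideanSpace ℝ (Fin m)))
    [DiscreteTopology Λ] [IsZLattice ℝ Λ]
    (T : Finset (EuclideanSpace ℝ (Fin m))) (hT : ∀ t ∈ T, t ∈ Λ)
    (h0 : (0 : EuclideanSpace ℝ (Fin m)) ∉ convexHull ℝ (T : Set (EuclideanSpace ℝ (Fin m))))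
    (hs : Submodule.span ℝ (T : Set (EuclideanSpace ℝ (Fin m))) = ⊤) :
    volume.real (convexHull ℝ (T : Set (EuclideanSpace ℝ (Fin m)))) +
        ZLattice.covolume Λ volume / m.factorial ≤
      volume.real (convexHull ℝ (insert 0 (T : Set (EuclideanSpace ℝ (Fin m))))) := by
  obtain ⟨f, hf, hspan⟩ := tight_functional T h0 hs
  obtain ⟨B, hBT, hBs, hBi⟩ := exists_linearIndependent ℝ {t | t ∈ T ∧ f t = 1}
  rw [hspan] at hBs
  let b0 : Module.Basis B ℝ (EuclideanSpace ℝ (Fin m)) :=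
    Module.Basis.mk hBi (by rw [Subtype.range_coe, hBs])
  have : Finite B := Module.Finite.finite_basis b0
  have : Fintype B := Fintype.ofFinite B
  have hcard : Fintype.card B = Fintype.card (Fin m) := by
    rw [← Module.finrank_eq_card_basis b0]; simp
  let b := b0.reindex (Fintype.equivOfCardEq hcard)
  have hb : ∀ i, b i ∈ T ∧ f (b i) = 1 := by
    intro i
    have : b i ∈ B := by simp [b, b0]
    exact hBT this
  have hsimp := simplex_lattice Λ b fun i => hT _ (hb i).1
  have hc1 : IsCompact (convexHull ℝ (insert 0 (Set.range b))) :=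
    ((Set.finite_range b).insert 0).isCompact_convexHull ℝ
  have hc2 : IsCompact (convexHull ℝ (T : Set (EuclideanSpace ℝ (Fin m)))) :=
    T.finite_toSet.isCompact_convexHull ℝ
  have hc3 : IsCompact (convexHull ℝ (insert 0 (T : Set (EuclideanSpace ℝ (Fin m))))) :=
    (T.finite_toSet.insert 0).isCompact_convexHull ℝ
  have hsub1 : convexHull ℝ (insert 0 (Set.range b)) ⊆ {x | f x ≤ 1} := by
    apply convexHull_min
    · rintro x (rfl | ⟨i, rfl⟩)
      · simp
      · exact (hb i).2.le
    · exact convex_halfSpace_le f.isLinear 1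
  have hsub2 : convexHull ℝ (T : Set (EuclideanSpace ℝ (Fin m))) ⊆ {x | 1 ≤ f x} := by
    apply convexHull_min
    · exact hf
    · exact convex_halfSpace_ge f.isLinear 1
  have hnull : volume {x | f x = 1} = 0 := by
    let A : AffineSubspace ℝ (EuclideanSpace ℝ (Fin m)) :=
      (affineSpan ℝ {(1:ℝ)}).comap f.toAffineMap
    have hA : (A : Set (EuclideanSpace ℝ (Fin m))) = {x | f x = 1} := by
      ext x
      simp [A]
    rw [← hA]
    apply Measure.addHaar_affineSubspace
    intro htop
    have : (0 : EuclideanSpace ℝ (Fin m)) ∈ (A : Set (EuclideanSpace ℝ (Fin m))) := by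
      rw [htop]; trivial
    rw [hA] at this
    simp at this
  have hdisj : AEDisjoint volume (convexHull ℝ (T : Set (EuclideanSpace ℝ (Fin m))))
      (convexHull ℝ (insert 0 (Set.range b))) := by
    refine measure_mono_null ?_ hnull
    rintro x ⟨hx1, hx2⟩
    exact le_antisymm (hsub1 hx2) (hsub2 hx1)
  have hunion : volume.real (convexHull ℝ (T : Set (EuclideanSpace ℝ (Fin m))) ∪
      convexHull ℝ (insert 0 (Set.range b))) = _ :=
    measureReal_union₀ hc1.measurableSet.nullMeasurableSet hdisj hc2.measure_lt_top.ne
      hc1.measure_lt_top.ne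
  have hmono : volume.real (convexHull ℝ (T : Set (EuclideanSpace ℝ (Fin m))) ∪
      convexHull ℝ (insert 0 (Set.range b))) ≤
      volume.real (convexHull ℝ (insert 0 (T : Set (EuclideanSpace ℝ (Fin m))))) := by
    apply measureReal_mono _ hc3.measure_lt_top.ne
    apply Set.union_subset
    · exact convexHull_mono (Set.subset_insert _ _)
    · apply convexHull_mono
      apply Set.insert_subset_insert
      rintro _ ⟨i, rfl⟩
      exact (hb i).1
  linarith

open scoped Pointwise in
lemma increment {m : ℕ} (Λ : Submodule ℤ (EuclideanSpace ℝ (Fin m)))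
    [DiscreteTopology Λ] [IsZLattice ℝ Λ] [DecidableEq (EuclideanSpace ℝ (Fin m))]
    (S : Finset (EuclideanSpace ℝ (Fin m))) (hS : ∀ t ∈ S, t ∈ Λ)
    (x : EuclideanSpace ℝ (Fin m)) (hx : x ∈ S)
    (h0 : x ∉ convexHull ℝ ((S.erase x : Finset _) : Set (EuclideanSpace ℝ (Fin m))))
    (hs : affineSpan ℝ (S : Set (EuclideanSpace ℝ (Fin m))) = ⊤) :
    volume.real (convexHull ℝ ((S.erase x : Finset _) : Set (EuclideanSpace ℝ (Fin m)))) +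
        ZLattice.covolume Λ volume / m.factorial ≤
      volume.real (convexHull ℝ (S : Set (EuclideanSpace ℝ (Fin m)))) := by
  let T : Finset (EuclideanSpace ℝ (Fin m)) := (S.erase x).image fun s => -x + s
  have hTc : (T : Set (EuclideanSpace ℝ (Fin m))) =
      -x +ᵥ ((S.erase x : Finset _) : Set (EuclideanSpace ℝ (Fin m))) := by
    simp only [T, Finset.coe_image]; rfl
  have hTi : insert 0 (T : Set (EuclideanSpace ℝ (Fin m))) =
      -x +ᵥ (S : Set (EuclideanSpace ℝ (Fin m))) := by
    rw [hTc]
    conv_rhs => rw [← Finset.insert_erase hx, Finset.coe_insert]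
    rw [← Set.image_vadd, ← Set.image_vadd, Set.image_insert_eq]
    simp
  have h := increment_zero Λ T (by
      intro t ht
      simp only [T, Finset.mem_image] at ht
      obtain ⟨s, hs, rfl⟩ := ht
      exact Λ.add_mem (Λ.neg_mem (hS x hx)) (hS s (Finset.mem_of_mem_erase hs)))
    (by
      rw [hTc, convexHull_vadd]
      intro hmem
      rw [Set.mem_vadd_set] at hmem
      obtain ⟨y, hy, hxy⟩ := hmem
      have : y = x := by
        rw [vadd_eq_add] at hxy
        exact (neg_add_eq_zero.1 hxy).symm
      exact h0 (this ▸ hy))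
    (by
      have h1 : vectorSpan ℝ (S : Set (EuclideanSpace ℝ (Fin m))) = ⊤ := by
        rw [← direction_affineSpan, hs, AffineSubspace.direction_top]
      rw [vectorSpan_eq_span_vsub_set_right ℝ (show x ∈ (S : Set _) from hx)] at h1
      rw [← h1, ← Submodule.span_insert_zero, hTi]
      congr 1
      rw [← Set.image_vadd]
      apply Set.image_congr
      intro a _
      simp [neg_add_eq_sub])
  rw [hTi, hTc, convexHull_vadd, convexHull_vadd] at h
  simpa [Measure.real, measure_vadd] using h

lemma count_bound {m : ℕ} (Λ : Submodule ℤ (EuclideanSpace ℝ (Fin m)))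
    [DiscreteTopology Λ] [IsZLattice ℝ Λ] (n : ℕ) :
    ∀ (S : Finset (EuclideanSpace ℝ (Fin m))), S.card = m + 1 + n → (∀ t ∈ S, t ∈ Λ) →
    affineSpan ℝ (S : Set (EuclideanSpace ℝ (Fin m))) = ⊤ →
    (n + 1) * (ZLattice.covolume Λ volume / m.factorial) ≤
      volume.real (convexHull ℝ (S : Set (EuclideanSpace ℝ (Fin m)))) := by
  classical
  induction n with
  | zero =>
    intro S hcard hS hs
    have hcomp : IsCompact (convexHull ℝ (S : Set (EuclideanSpace ℝ (Fin m)))) :=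
      S.finite_toSet.isCompact_convexHull ℝ
    have hne : S.Nonempty := by rw [← Finset.card_pos]; omega
    obtain ⟨x, hx⟩ := hcomp.extremePoints_nonempty (by simpa using hne)
    have hxS : x ∈ S := by simpa using extremePoints_convexHull_subset hx
    rw [(convex_convexHull ℝ _).mem_extremePoints_iff_convex_sdiff] at hx
    have := increment Λ S hS x hxS (by
      intro hmem
      have : convexHull ℝ ((S.erase x : Finset _) : Set (EuclideanSpace ℝ (Fin m))) ⊆
          convexHull ℝ (S : Set (EuclideanSpace ℝ (Fin m))) \ {x} := by
        apply convexHull_min _ hx.2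
        intro y hy
        simp at hy
        exact ⟨subset_convexHull ℝ _ hy.1, hy.2⟩
      exact (this hmem).2 rfl) hs
    have h2 : 0 ≤ volume.real
      (convexHull ℝ ((S.erase x : Finset _) : Set (EuclideanSpace ℝ (Fin m)))) :=
      measureReal_nonneg
    simp only [Nat.cast_zero, zero_add, one_mul]
    linarith
  | succ n ih =>
    intro S hcard hS hs
    obtain ⟨x, hx, hxn, hsx⟩ := exists_removable S hs (by simp; omega)
    have h1 := ih (S.erase x) (by rw [Finset.card_erase_of_mem hx]; omega)
      (fun t ht => hS t (Finset.mem_of_mem_erase ht)) hsx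
    have h2 := increment Λ S hS x hx hxn hs
    push_cast
    linarith

/-- **Blichfeldt.** If `Λ ⊂ ℝ^m` is a (full-rank) lattice and `𝒞 ⊂ ℝ^m` is a bounded convex
set containing the origin such that `Λ ∩ 𝒞` contains `m` linearly independent vectors, then
`|Λ ∩ 𝒞| ≤ m!·vol(𝒞)/det(Λ) + m ≤ (m+1)!·vol(𝒞)/det(Λ)`. -/
theorem blichfeldt_count_bound (m : ℕ) (Λ : Submodule ℤ (EuclideanSpace ℝ (Fin m)))
    [DiscreteTopology Λ] [IsZLattice ℝ Λ]
    (C : Set (EuclideanSpace ℝ (Fin m))) (hC : Convex ℝ C)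
    (hCb : Bornology.IsBounded C) (h0 : (0 : EuclideanSpace ℝ (Fin m)) ∈ C)
    (hind : ∃ v : Fin m → EuclideanSpace ℝ (Fin m),
      (∀ i, v i ∈ Λ ∧ v i ∈ C) ∧ LinearIndependent ℝ v) :
    (((Λ : Set (EuclideanSpace ℝ (Fin m))) ∩ C).ncard : ℝ) ≤
        m.factorial * (volume C).toReal / ZLattice.covolume Λ volume + m ∧
      (m.factorial : ℝ) * (volume C).toReal / ZLattice.covolume Λ volume + m ≤
        (m + 1).factorial * (volume C).toReal / ZLattice.covolume Λ volume := by
  have hfin : ((Λ : Set (EuclideanSpace ℝ (Fin m))) ∩ C).Finite := by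
    have hcl : IsClosed (Λ : Set (EuclideanSpace ℝ (Fin m))) := by
      have : DiscreteTopology Λ.toAddSubgroup := inferInstanceAs (DiscreteTopology Λ)
      exact AddSubgroup.isClosed_of_discrete (H := Λ.toAddSubgroup)
    rw [Set.inter_comm]
    exact Metric.finite_isBounded_inter_isClosed DiscreteTopology.isDiscrete hCb hcl
  set S : Finset (EuclideanSpace ℝ (Fin m)) := hfin.toFinset with hSdef
  have hSc : (S : Set (EuclideanSpace ℝ (Fin m))) =
      (Λ : Set (EuclideanSpace ℝ (Fin m))) ∩ C := hfin.coe_toFinset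
  obtain ⟨v, hv, hvi⟩ := hind
  have hspanv : Submodule.span ℝ (Set.range v) = ⊤ :=
    hvi.span_eq_top_of_card_eq_finrank' (by simp)
  have h0S : (0 : EuclideanSpace ℝ (Fin m)) ∈ (S : Set (EuclideanSpace ℝ (Fin m))) := by
    rw [hSc]; exact ⟨Λ.zero_mem, h0⟩
  have hvS : Set.range v ⊆ (S : Set (EuclideanSpace ℝ (Fin m))) := by
    rintro _ ⟨i, rfl⟩
    rw [hSc]; exact hv i
  have hs : affineSpan ℝ (S : Set (EuclideanSpace ℝ (Fin m))) = ⊤ := by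
    rw [AffineSubspace.affineSpan_eq_top_iff_vectorSpan_eq_top_of_nonempty ℝ _ _ ⟨0, h0S⟩,
      vectorSpan_eq_span_vsub_set_right ℝ h0S, eq_top_iff, ← hspanv]
    apply Submodule.span_mono
    intro y hy
    exact ⟨y, hvS hy, by simp⟩
  have hcard : m + 1 ≤ S.card := by
    classical
    have h1 : insert 0 (Finset.univ.image v) ⊆ S := by
      intro y hy
      rw [Finset.mem_insert, Finset.mem_image] at hy
      rcases hy with rfl | ⟨i, -, rfl⟩
      · exact h0S
      · exact hvS ⟨i, rfl⟩
    have h2 := Finset.card_le_card h1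
    rw [Finset.card_insert_of_notMem, Finset.card_image_of_injective _ hvi.injective] at h2
    · simpa using h2
    · simp only [Finset.mem_image, not_exists, not_and]
      intro i _ h
      exact hvi.ne_zero i h
  obtain ⟨n, hn⟩ := Nat.exists_eq_add_of_le hcard
  have hSΛ : ∀ t ∈ S, t ∈ Λ := by
    intro t ht
    have : t ∈ (S : Set (EuclideanSpace ℝ (Fin m))) := ht
    rw [hSc] at this
    exact this.1
  have hb := count_bound Λ n S hn hSΛ hs
  have hmono : volume.real (convexHull ℝ (S : Set (EuclideanSpace ℝ (Fin m)))) ≤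
      (volume C).toReal := by
    apply measureReal_mono _ hCb.measure_lt_top.ne
    apply convexHull_min _ hC
    rw [hSc]
    exact Set.inter_subset_right
  have hd : 0 < ZLattice.covolume Λ volume := ZLattice.covolume_pos Λ volume
  have hkey : (n : ℝ) + 1 ≤ m.factorial * (volume C).toReal / ZLattice.covolume Λ volume := by
    have hf : (0 : ℝ) < m.factorial := by exact_mod_cast m.factorial_pos
    have h3 := hb.trans hmono
    rw [← mul_div_assoc, div_le_iff₀ hf] at h3
    rw [le_div_iff₀ hd]
    linarith
  have hnc : (((Λ : Set (EuclideanSpace ℝ (Fin m))) ∩ C).ncard : ℝ) = m + 1 + n := by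
    rw [← hSc, Set.ncard_coe_finset, hn]; push_cast; ring
  constructor
  · rw [hnc]; linarith
  · have h1 : (1 : ℝ) ≤ m.factorial * (volume C).toReal / ZLattice.covolume Λ volume := by
      have : (0 : ℝ) ≤ n := Nat.cast_nonneg n
      linarith
    have h2 : ((m + 1).factorial : ℝ) * (volume C).toReal / ZLattice.covolume Λ volume =
        (m + 1) * (m.factorial * (volume C).toReal / ZLattice.covolume Λ volume) := by
      rw [Nat.factorial_succ]; push_cast; ring
    rw [h2]
    have : (0 : ℝ) ≤ m := Nat.cast_nonneg m
    nlinarith
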